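/- The logic ITL^FS is sound for the class of open dynamical systems: if ITL^FS ⊢ φ, then for every dynamical system (X,T,S) in which S is additionally an open map, and every valuation ⟦·⟧ on it, ⟦φ⟧ = X. -/

import Mathlib

/-- Formulas of the language `L` of intuitionistic linear temporal logic. -/
inductive Formula : Type
  | bot : Formula
  | var : ℕ → Formula
  | and : Formula → Formula → Formula
  | or : Formula → Formula → Formula
  | impl : Formula → Formula → Formula
  | next : Formula → Formula
  | diam : Formula → Formula
  | box : Formula → Formula
deriving DecidableEq

namespace Formula

/-- `¬φ` abbreviates `φ → ⊥`. -/
def neg (φ : Formula) : Formula := impl φ bot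

/-- `φ ↔ ψ` abbreviates `(φ → ψ) ∧ (ψ → φ)`. -/
def iff (φ ψ : Formula) : Formula := and (impl φ ψ) (impl ψ φ)

end Formula

/-- Derivability in `ITL⁰` extended with an additional set of axioms `Ax`.
The intuitionistic propositional tautologies are generated by a standard
complete Hilbert-style axiomatization of intuitionistic propositional logic
(closed under modus ponens). -/
inductive ITL (Ax : Formula → Prop) : Formula → Prop
  | extra {φ} : Ax φ → ITL Ax φ
  -- (i) intuitionistic propositional axioms
  | then1 (φ ψ : Formula) : ITL Ax (.impl φ (.impl ψ φ))
  | then2 (φ ψ χ : Formula) :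
      ITL Ax (.impl (.impl φ (.impl ψ χ)) (.impl (.impl φ ψ) (.impl φ χ)))
  | andE1 (φ ψ : Formula) : ITL Ax (.impl (.and φ ψ) φ)
  | andE2 (φ ψ : Formula) : ITL Ax (.impl (.and φ ψ) ψ)
  | andI (φ ψ : Formula) : ITL Ax (.impl φ (.impl ψ (.and φ ψ)))
  | orI1 (φ ψ : Formula) : ITL Ax (.impl φ (.or φ ψ))
  | orI2 (φ ψ : Formula) : ITL Ax (.impl ψ (.or φ ψ))
  | orE (φ ψ χ : Formula) :
      ITL Ax (.impl (.impl φ χ) (.impl (.impl ψ χ) (.impl (.or φ ψ) χ)))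
  | botE (φ : Formula) : ITL Ax (.impl .bot φ)
  -- (ii)–(x) temporal axioms
  | nextBot : ITL Ax (.neg (.next .bot))
  | nextAnd (φ ψ : Formula) :
      ITL Ax (.iff (.next (.and φ ψ)) (.and (.next φ) (.next ψ)))
  | nextOr (φ ψ : Formula) :
      ITL Ax (.iff (.next (.or φ ψ)) (.or (.next φ) (.next ψ)))
  | nextK (φ ψ : Formula) :
      ITL Ax (.impl (.next (.impl φ ψ)) (.impl (.next φ) (.next ψ)))
  | boxK (φ ψ : Formula) :
      ITL Ax (.impl (.box (.impl φ ψ)) (.impl (.box φ) (.box ψ)))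
  | diamK (φ ψ : Formula) :
      ITL Ax (.impl (.box (.impl φ ψ)) (.impl (.diam φ) (.diam ψ)))
  | diamOr (φ ψ : Formula) :
      ITL Ax (.impl (.diam (.or φ ψ)) (.or (.diam φ) (.diam ψ)))
  | boxFix (φ : Formula) : ITL Ax (.impl (.box φ) (.and φ (.next (.box φ))))
  | diamFix (φ : Formula) : ITL Ax (.impl (.or φ (.next (.diam φ))) (.diam φ))
  -- rules (xi)–(xiv)
  | ind1 {φ : Formula} : ITL Ax (.impl φ (.next φ)) → ITL Ax (.impl φ (.box φ))
  | ind2 {φ : Formula} : ITL Ax (.impl (.next φ) φ) → ITL Ax (.impl (.diam φ) φ)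
  | mp {φ ψ : Formula} : ITL Ax (.impl φ ψ) → ITL Ax φ → ITL Ax ψ
  | nec {φ : Formula} : ITL Ax φ → ITL Ax (.next φ)

/-- The Fischer Servi axiom schemes FS◦ and FS◇. -/
def FSAx : Formula → Prop := fun χ => ∃ φ ψ : Formula,
  χ = .impl (.impl (.next φ) (.next ψ)) (.next (.impl φ ψ)) ∨
  χ = .impl (.impl (.diam φ) (.box ψ)) (.box (.impl φ ψ))

/-- The constant domain axiom scheme CD. -/
def CDAx : Formula → Prop := fun χ => ∃ φ ψ : Formula,
  χ = .impl (.box (.or φ ψ)) (.or (.box φ) (.diam ψ))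

/-- The logic ITL⁰. -/
def ITL0 : Formula → Prop := ITL (fun _ => False)

/-- The logic ITL^FS = ITL⁰ + FS◦ + FS◇. -/
def ITLFS : Formula → Prop := ITL FSAx

/-- The logic ITL^CD = ITL⁰ + CD. -/
def ITLCD : Formula → Prop := ITL CDAx

/-- The logic ITL¹ = ITL^FS + ITL^CD. -/
def ITL1 : Formula → Prop := ITL (fun χ => FSAx χ ∨ CDAx χ)

/-- A valuation on a dynamical topological system `(X, T, S)`: a map from
formulas to open sets satisfying the semantic clauses. -/
structure DTValuation (X : Type) (T : TopologicalSpace X) (S : X → X) where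
  val : Formula → Set X
  isOpen_val : ∀ φ, @IsOpen X T (val φ)
  val_bot : val .bot = ∅
  val_and : ∀ φ ψ, val (.and φ ψ) = val φ ∩ val ψ
  val_or : ∀ φ ψ, val (.or φ ψ) = val φ ∪ val ψ
  val_impl : ∀ φ ψ, val (.impl φ ψ) = @interior X T ((val φ)ᶜ ∪ val ψ)
  val_next : ∀ φ, val (.next φ) = S ⁻¹' val φ
  val_diam : ∀ φ, val (.diam φ) = ⋃ n : ℕ, (S^[n]) ⁻¹' val φ
  val_box : ∀ φ, val (.box φ) =
    ⋃₀ {U : Set X | @IsOpen X T U ∧ S '' U ⊆ U ∧ U ⊆ val φ}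

/-- The up-set topology of a preorder: the open sets are the upward closed sets. -/
def upsetTopology (X : Type) [Preorder X] : TopologicalSpace X where
  IsOpen U := IsUpperSet U
  isOpen_univ := isUpperSet_univ
  isOpen_inter := fun _ _ hU hV => hU.inter hV
  isOpen_sUnion := fun _ hs => isUpperSet_sUnion hs

theorem IsOpenMap.iterate {X : Type*} [TopologicalSpace X] {f : X → X} (hf : IsOpenMap f) :
    ∀ n : ℕ, IsOpenMap f^[n]
  | 0 => IsOpenMap.id
  | n + 1 => (hf.iterate n).comp hf

namespace DTValuation

variable {X : Type} {T : TopologicalSpace X} {S : X → X} (V : DTValuation X T S)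

theorem subset_val_impl {U : Set X} (hU : IsOpen U) {φ ψ : Formula} :
    U ⊆ V.val (.impl φ ψ) ↔ U ∩ V.val φ ⊆ V.val ψ := by
  rw [V.val_impl, hU.subset_interior_iff]
  refine ⟨fun h x hx => (h hx.1).resolve_left fun hn => hn hx.2, fun h x hx => ?_⟩
  by_cases hφ : x ∈ V.val φ
  exacts [Or.inr (h ⟨hx, hφ⟩), Or.inl hφ]

theorem val_impl_eq_univ {φ ψ : Formula} :
    V.val (.impl φ ψ) = Set.univ ↔ V.val φ ⊆ V.val ψ := by
  rw [← Set.univ_subset_iff, V.subset_val_impl isOpen_univ, Set.univ_inter]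

theorem val_impl_impl_eq_univ {φ ψ χ : Formula} :
    V.val (.impl φ (.impl ψ χ)) = Set.univ ↔ V.val φ ∩ V.val ψ ⊆ V.val χ := by
  rw [val_impl_eq_univ, V.subset_val_impl (V.isOpen_val φ)]

theorem val_impl_impl_impl_eq_univ {φ ψ χ θ : Formula} :
    V.val (.impl φ (.impl ψ (.impl χ θ))) = Set.univ ↔
      V.val φ ∩ V.val ψ ∩ V.val χ ⊆ V.val θ := by
  rw [val_impl_impl_eq_univ, V.subset_val_impl ((V.isOpen_val φ).inter (V.isOpen_val ψ))]

theorem val_iff_eq_univ {φ ψ : Formula} :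
    V.val (.iff φ ψ) = Set.univ ↔ V.val φ = V.val ψ := by
  rw [Formula.iff, V.val_and, ← Set.univ_subset_iff, Set.subset_inter_iff, Set.univ_subset_iff,
    Set.univ_subset_iff, val_impl_eq_univ, val_impl_eq_univ, Set.Subset.antisymm_iff]

theorem mem_val_of_mem_val_impl {φ ψ : Formula} {x : X} (h : x ∈ V.val (.impl φ ψ))
    (hx : x ∈ V.val φ) : x ∈ V.val ψ :=
  (V.subset_val_impl (V.isOpen_val _)).1 subset_rfl ⟨h, hx⟩

theorem mem_val_diam {φ : Formula} {x : X} :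
    x ∈ V.val (.diam φ) ↔ ∃ n : ℕ, S^[n] x ∈ V.val φ := by
  simp [V.val_diam]

theorem subset_val_box {U : Set X} (hU : IsOpen U) (hSU : Set.MapsTo S U U) {φ : Formula}
    (h : U ⊆ V.val φ) : U ⊆ V.val (.box φ) := by
  rw [V.val_box]
  exact Set.subset_sUnion_of_mem ⟨hU, hSU.image_subset, h⟩

theorem val_box_subset (φ : Formula) : V.val (.box φ) ⊆ V.val φ := by
  rw [V.val_box]
  exact Set.sUnion_subset fun U hU => hU.2.2

theorem mapsTo_val_box (φ : Formula) : Set.MapsTo S (V.val (.box φ)) (V.val (.box φ)) := by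
  rw [V.val_box]
  rintro x ⟨U, hU, hx⟩
  exact ⟨U, hU, hU.2.1 (Set.mem_image_of_mem S hx)⟩

theorem iterate_mem_val_of_mem_val_box {φ : Formula} {x : X} (hx : x ∈ V.val (.box φ)) (n : ℕ) :
    S^[n] x ∈ V.val φ :=
  V.val_box_subset φ ((V.mapsTo_val_box φ).iterate n hx)

/-- Validity of the scheme FS◦ when `S` is open. -/
theorem val_next_fischerServi (hSopen : IsOpenMap S) (φ ψ : Formula) :
    V.val (.impl (.impl (.next φ) (.next ψ)) (.next (.impl φ ψ))) = Set.univ := by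
  rw [val_impl_eq_univ, V.val_next (.impl φ ψ), ← Set.image_subset_iff,
    V.subset_val_impl (hSopen _ (V.isOpen_val _))]
  rintro _ ⟨⟨x, hx, rfl⟩, hφ⟩
  have hψ := V.mem_val_of_mem_val_impl hx (by rwa [V.val_next])
  rwa [V.val_next] at hψ

/-- Validity of the scheme FS◇ when `S` is open: the forward orbit of `⟦◇φ → □ψ⟧` is an open
invariant set contained in `⟦φ → ψ⟧`. -/
theorem val_diam_fischerServi (hSopen : IsOpenMap S) (φ ψ : Formula) :
    V.val (.impl (.impl (.diam φ) (.box ψ)) (.box (.impl φ ψ))) = Set.univ := by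
  rw [val_impl_eq_univ]
  set W := V.val (.impl (.diam φ) (.box ψ))
  have hopen : IsOpen (⋃ n : ℕ, S^[n] '' W) :=
    isOpen_iUnion fun n => hSopen.iterate n _ (V.isOpen_val _)
  refine (Set.subset_iUnion_of_subset 0 (by simp)).trans (V.subset_val_box hopen ?_ ?_)
  · intro y hy
    obtain ⟨n, x, hx, rfl⟩ := Set.mem_iUnion.1 hy
    exact Set.mem_iUnion.2 ⟨n + 1, x, hx, Function.iterate_succ_apply' S n x⟩
  · rw [V.subset_val_impl hopen]
    rintro y ⟨hy, hφ⟩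
    obtain ⟨n, x, hx, rfl⟩ := Set.mem_iUnion.1 hy
    exact V.iterate_mem_val_of_mem_val_box
      (V.mem_val_of_mem_val_impl hx (V.mem_val_diam.2 ⟨n, hφ⟩)) n

/-- Soundness of `ITL⁰` extended with any set of axioms valid under `V`. -/
theorem val_eq_univ_of_ITL {Ax : Formula → Prop}
    (hAx : ∀ φ, Ax φ → V.val φ = Set.univ) {φ : Formula} (h : ITL Ax φ) :
    V.val φ = Set.univ := by
  induction h with
  | extra h => exact hAx _ h
  | then1 φ ψ => exact V.val_impl_impl_eq_univ.2 Set.inter_subset_left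
  | then2 φ ψ χ =>
    refine V.val_impl_impl_impl_eq_univ.2 fun x ⟨⟨h₁, h₂⟩, hφ⟩ => ?_
    exact V.mem_val_of_mem_val_impl (V.mem_val_of_mem_val_impl h₁ hφ)
      (V.mem_val_of_mem_val_impl h₂ hφ)
  | andE1 φ ψ => exact V.val_impl_eq_univ.2 (V.val_and φ ψ ▸ Set.inter_subset_left)
  | andE2 φ ψ => exact V.val_impl_eq_univ.2 (V.val_and φ ψ ▸ Set.inter_subset_right)
  | andI φ ψ => exact V.val_impl_impl_eq_univ.2 (V.val_and φ ψ).ge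
  | orI1 φ ψ => exact V.val_impl_eq_univ.2 (V.val_or φ ψ ▸ Set.subset_union_left)
  | orI2 φ ψ => exact V.val_impl_eq_univ.2 (V.val_or φ ψ ▸ Set.subset_union_right)
  | orE φ ψ χ =>
    refine V.val_impl_impl_impl_eq_univ.2 fun x ⟨⟨h₁, h₂⟩, hx⟩ => ?_
    rw [V.val_or] at hx
    exact hx.elim (V.mem_val_of_mem_val_impl h₁) (V.mem_val_of_mem_val_impl h₂)
  | botE φ => exact V.val_impl_eq_univ.2 (V.val_bot ▸ Set.empty_subset _)
  | nextBot =>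
    exact V.val_impl_eq_univ.2 (by rw [V.val_next, V.val_bot, Set.preimage_empty])
  | nextAnd φ ψ => simp only [val_iff_eq_univ, V.val_next, V.val_and, Set.preimage_inter]
  | nextOr φ ψ => simp only [val_iff_eq_univ, V.val_next, V.val_or, Set.preimage_union]
  | nextK φ ψ =>
    simp only [val_impl_impl_eq_univ, V.val_next]
    exact fun x hx => V.mem_val_of_mem_val_impl hx.1 hx.2
  | boxK φ ψ =>
    refine V.val_impl_impl_eq_univ.2 (V.subset_val_box
      ((V.isOpen_val _).inter (V.isOpen_val _)) ?_ fun x hx => ?_)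
    · exact (V.mapsTo_val_box _).inter_inter (V.mapsTo_val_box _)
    · exact V.mem_val_of_mem_val_impl (V.val_box_subset _ hx.1) (V.val_box_subset _ hx.2)
  | diamK φ ψ =>
    refine V.val_impl_impl_eq_univ.2 fun x ⟨hbox, hx⟩ => ?_
    obtain ⟨n, hn⟩ := V.mem_val_diam.1 hx
    exact V.mem_val_diam.2
      ⟨n, V.mem_val_of_mem_val_impl (V.iterate_mem_val_of_mem_val_box hbox n) hn⟩
  | diamOr φ ψ =>
    simp only [val_impl_eq_univ, V.val_or, V.val_diam, Set.preimage_union, Set.iUnion_union_distrib,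
      subset_rfl]
  | boxFix φ =>
    rw [val_impl_eq_univ, V.val_and, V.val_next]
    exact Set.subset_inter (V.val_box_subset φ) (V.mapsTo_val_box φ)
  | diamFix φ =>
    rw [val_impl_eq_univ, V.val_or, V.val_next]
    rintro x (hx | hx)
    · exact V.mem_val_diam.2 ⟨0, hx⟩
    · obtain ⟨n, hn⟩ := V.mem_val_diam.1 hx
      exact V.mem_val_diam.2 ⟨n + 1, hn⟩
  | @ind1 φ _ ih =>
    rw [val_impl_eq_univ, V.val_next] at ih
    exact V.val_impl_eq_univ.2 (V.subset_val_box (V.isOpen_val φ) ih subset_rfl)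
  | @ind2 φ _ ih =>
    rw [val_impl_eq_univ, V.val_next] at ih
    refine V.val_impl_eq_univ.2 fun x hx => ?_
    obtain ⟨n, hn⟩ := V.mem_val_diam.1 hx
    induction n with
    | zero => exact hn
    | succ n ihn => exact ihn (ih (by rwa [Function.iterate_succ_apply'] at hn))
  | mp _ _ ih₁ ih₂ =>
    rw [val_impl_eq_univ, ih₂] at ih₁
    exact Set.univ_subset_iff.1 ih₁
  | nec _ ih => rw [V.val_next, ih, Set.preimage_univ]

end DTValuation

/-- Theorem 3: soundness of ITL^FS for the class of open dynamical systems. -/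
theorem itlfs_sound (φ : Formula) (h : ITLFS φ)
    (X : Type) (T : TopologicalSpace X) (S : X → X)
    (hS : @Continuous X X T T S) (hSopen : @IsOpenMap X X T T S)
    (V : DTValuation X T S) : V.val φ = Set.univ := by
  refine V.val_eq_univ_of_ITL ?_ h
  rintro _ ⟨φ, ψ, rfl | rfl⟩
  exacts [V.val_next_fischerServi hSopen φ ψ, V.val_diam_fischerServi hSopen φ ψ]
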